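/- Define u : ℕ → ℕ by u(n) = (3^(n+2) − 5)/2 (an integer for every n). Then for every integer k ≥ 1 and all natural numbers n, m: n ≡ m (mod 2^k) if and only if u(n) ≡ u(m) (mod 2^(k+1)). -/

import Mathlib

/-- `u n = (3^(n+2) - 5)/2` (an integer for every `n`). -/
def u (n : ℕ) : ℕ := (3^(n+2) - 5)/2

theorem three_pow_two_pow_succ (j : ℕ) :
    ∃ c : ℕ, 3 ^ 2 ^ (j + 1) = 1 + 2 ^ (j + 3) * (2 * c + 1) := by
  induction j with
  | zero => exact ⟨0, by norm_num⟩
  | succ j ih =>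
    obtain ⟨c, hc⟩ := ih
    refine ⟨c + 2 ^ (j + 1) * (2 * c + 1) ^ 2, ?_⟩
    rw [pow_succ 2 (j + 1), pow_mul, hc]
    ring

theorem three_pow_modEq_three_pow_iff (j a b : ℕ) :
    3 ^ a ≡ 3 ^ b [MOD 2 ^ (j + 3)] ↔ a ≡ b [MOD 2 ^ (j + 1)] := by
  have hcop : Nat.Coprime 3 (2 ^ (j + 3)) := Nat.Coprime.pow_right _ (by norm_num)
  have key (a b : ℕ) : ZMod.unitOfCoprime 3 hcop ^ a = ZMod.unitOfCoprime 3 hcop ^ b ↔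
      3 ^ a ≡ 3 ^ b [MOD 2 ^ (j + 3)] := by
    rw [Units.ext_iff, ← ZMod.natCast_eq_natCast_iff]
    simp
  have hord : orderOf (ZMod.unitOfCoprime 3 hcop) = 2 ^ (j + 1) := by
    apply orderOf_eq_prime_pow
    · rw [← pow_zero (ZMod.unitOfCoprime 3 hcop), key, pow_zero, Nat.ModEq.comm,
        Nat.modEq_iff_dvd' (Nat.one_le_pow _ _ (by norm_num))]
      rcases j with _ | j
      · norm_num
      · obtain ⟨c, hc⟩ := three_pow_two_pow_succ j
        rw [hc, Nat.add_sub_cancel_left, show j + 1 + 3 = (j + 3) + 1 by ring, pow_succ,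
          Nat.mul_dvd_mul_iff_left (by positivity)]
        omega
    · rw [← pow_zero (ZMod.unitOfCoprime 3 hcop), key, pow_zero, Nat.ModEq.comm,
        Nat.modEq_iff_dvd' (Nat.one_le_pow _ _ (by norm_num))]
      obtain ⟨c, hc⟩ := three_pow_two_pow_succ j
      rw [hc, Nat.add_sub_cancel_left]
      exact dvd_mul_right _ _
  rw [← key, pow_eq_pow_iff_modEq, hord]

theorem two_mul_u_add_five (n : ℕ) : 2 * u n + 5 = 3 ^ (n + 2) := by
  have hodd : 3 ^ (n + 2) % 2 = 1 := Nat.odd_iff.mp (Odd.pow (by decide))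
  have hle : 3 ^ 2 ≤ 3 ^ (n + 2) := Nat.pow_le_pow_right (by norm_num) (by omega)
  unfold u
  omega

theorem stmt16 :
    ∀ k : ℕ, 1 ≤ k → ∀ n m : ℕ, n ≡ m [MOD 2^k] ↔ u n ≡ u m [MOD 2^(k+1)] := by
  intro k hk n m
  obtain ⟨j, rfl⟩ := Nat.exists_eq_add_of_le' hk
  have hmul : 2 * u n ≡ 2 * u m [MOD 2 * 2 ^ (j + 1 + 1)] ↔ u n ≡ u m [MOD 2 ^ (j + 1 + 1)] :=
    ⟨Nat.ModEq.mul_left_cancel' (by norm_num), Nat.ModEq.mul_left' 2⟩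
  have hadd : n + 2 ≡ m + 2 [MOD 2 ^ (j + 1)] ↔ n ≡ m [MOD 2 ^ (j + 1)] :=
    ⟨Nat.ModEq.add_right_cancel' 2, Nat.ModEq.add_right 2⟩
  have hadd' : 2 * u n + 5 ≡ 2 * u m + 5 [MOD 2 ^ (j + 3)] ↔
      2 * u n ≡ 2 * u m [MOD 2 ^ (j + 3)] :=
    ⟨Nat.ModEq.add_right_cancel' 5, Nat.ModEq.add_right 5⟩
  rw [← hmul, ← pow_succ', ← hadd', two_mul_u_add_five, two_mul_u_add_five,
    three_pow_modEq_three_pow_iff, hadd]
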